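/- Let (Ω,ρ) be a compact connected metric space with positive K-capacity in which every nonempty ball has positive K-capacity, σ a fully supported probability measure, and K : Ω × Ω → [0,∞] a symmetric extended-continuous kernel that is regular and entirely subharmonic with respect to σ. Then a Borel probability measure μ is an energy minimizer for I_K if and only if μ is approximately K-invariant. -/

import Mathlib

open MeasureTheory Metric Set ENNReal

/-- The potential of a measure `μ` with respect to a kernel `K`. -/
noncomputable def pot {Ω : Type*} [MeasurableSpace Ω] (K : Ω → Ω → ℝ≥0∞)
    (μ : Measure Ω) (x : Ω) : ℝ≥0∞ := ∫⁻ y, K x y ∂μ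

/-- The energy of a measure `μ` with respect to a kernel `K`. -/
noncomputable def energy {Ω : Type*} [MeasurableSpace Ω] (K : Ω → Ω → ℝ≥0∞)
    (μ : Measure Ω) : ℝ≥0∞ := ∫⁻ x, ∫⁻ y, K x y ∂μ ∂μ

/-- The support of a Borel measure. -/
def msupp {Ω : Type*} [TopologicalSpace Ω] [MeasurableSpace Ω] (μ : Measure Ω) : Set Ω :=
  {x | ∀ V : Set Ω, IsOpen V → x ∈ V → 0 < μ V}

/-- A set has `K`-capacity zero if every probability measure supported in it has
infinite `K`-energy. -/
def CapacityZero {Ω : Type*} [TopologicalSpace Ω] [MeasurableSpace Ω]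
    (K : Ω → Ω → ℝ≥0∞) (E : Set Ω) : Prop :=
  ∀ ν : Measure Ω, IsProbabilityMeasure ν → msupp ν ⊆ E → energy K ν = ⊤

/-- A probability measure `μ` is approximately `K`-invariant if it has finite energy and
its potential equals a finite constant `M` outside a set of `K`-capacity zero. -/
def ApproxInvariant {Ω : Type*} [TopologicalSpace Ω] [MeasurableSpace Ω]
    (K : Ω → Ω → ℝ≥0∞) (μ : Measure Ω) : Prop :=
  IsProbabilityMeasure μ ∧ energy K μ ≠ ⊤ ∧
    ∃ M : ℝ≥0∞, M ≠ ⊤ ∧ CapacityZero K {x | pot K μ x ≠ M}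

/-- `K` is regular. -/
def Regular {Ω : Type*} [TopologicalSpace Ω] [MeasurableSpace Ω] (K : Ω → Ω → ℝ≥0∞) : Prop :=
  ∀ ν : Measure Ω, IsFiniteMeasure ν →
    ContinuousOn (pot K ν) (msupp ν) → (∀ x ∈ msupp ν, pot K ν x ≠ ⊤) →
    Continuous (pot K ν) ∧ ∀ x, pot K ν x ≠ ⊤

/-- `K` is entirely subharmonic with respect to `σ`. -/
def EntirelySubharmonic {Ω : Type*} [MetricSpace Ω] [MeasurableSpace Ω]
    (σ : Measure Ω) (K : Ω → Ω → ℝ≥0∞) : Prop :=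
  ∃ R > (0 : ℝ), ∀ y : Ω,
    (∀ x, x ≠ y → K x y ≠ ⊤) ∧
    ∀ (x₀ : Ω) (r : ℝ), 0 < r → r < R → closedBall x₀ r ⊆ {y}ᶜ →
      K x₀ y ≤ (∫⁻ z in closedBall x₀ r, K z y ∂σ) / σ (closedBall x₀ r)

theorem msupp_eq_support {Ω : Type*} [TopologicalSpace Ω] [MeasurableSpace Ω] (μ : Measure Ω) :
    msupp μ = μ.support := by
  rw [Measure.support_eq_forall_isOpen]
  ext x
  exact forall_congr' fun V => forall_comm

theorem energy_mono {Ω : Type*} [MeasurableSpace Ω] {K : Ω → Ω → ℝ≥0∞} {μ ν : Measure Ω}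
    (h : μ ≤ ν) : energy K μ ≤ energy K ν :=
  lintegral_mono' h fun _ => lintegral_mono' h le_rfl

theorem energy_smul {Ω : Type*} [MeasurableSpace Ω] {K : Ω → Ω → ℝ≥0∞} {c : ℝ≥0∞} (hc : c ≠ ⊤)
    (μ : Measure Ω) : energy K (c • μ) = c * (c * energy K μ) := by
  simp only [energy, lintegral_smul_measure, smul_eq_mul, lintegral_const_mul' _ _ hc]

theorem lowerSemicontinuous_pot {Ω : Type*} [MetricSpace Ω] [MeasurableSpace Ω] [BorelSpace Ω]
    {K : Ω → Ω → ℝ≥0∞} (hK : Continuous (Function.uncurry K)) (μ : Measure Ω) :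
    LowerSemicontinuous (pot K μ) := by
  intro x
  refine lowerSemicontinuousAt_iff_le_liminf.2 ?_
  have hlim (y : Ω) : Filter.liminf (fun x' => K x' y) (nhds x) = K x y :=
    (hK.comp (Continuous.prodMk_left y)).continuousAt.liminf_eq
  calc pot K μ x = ∫⁻ y, Filter.liminf (fun x' => K x' y) (nhds x) ∂μ := by simp only [hlim, pot]
    _ ≤ _ := lintegral_liminf_le fun x' => (hK.comp (Continuous.prodMk_right x')).measurable

/-- Restricting a measure to a compact set on which its potential is constant and finite gives a
measure whose potential is continuous on that set. -/
theorem continuousOn_pot_restrict {Ω : Type*} [MetricSpace Ω] [MeasurableSpace Ω] [BorelSpace Ω]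
    {K : Ω → Ω → ℝ≥0∞} (hK : Continuous (Function.uncurry K)) (μ : Measure Ω)
    {F : Set Ω} (hF : IsCompact F) {M : ℝ≥0∞} (hM : M ≠ ⊤) (hFM : ∀ x ∈ F, pot K μ x = M) :
    ContinuousOn (pot K (μ.restrict F)) F := by
  have hadd (x : Ω) : pot K (μ.restrict F) x + pot K (μ.restrict Fᶜ) x = pot K μ x :=
    lintegral_add_compl _ hF.measurableSet
  rw [continuousOn_iff_lower_upperSemicontinuousOn]
  refine ⟨(lowerSemicontinuous_pot hK _).lowerSemicontinuousOn F, ?_⟩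
  have husc : UpperSemicontinuous fun x => M - pot K (μ.restrict Fᶜ) x :=
    (ENNReal.continuous_sub_left hM).comp_lowerSemicontinuous_antitone
      (lowerSemicontinuous_pot hK _) fun a b hab => tsub_le_tsub_left hab M
  have heq (x : Ω) (hx : x ∈ F) : M - pot K (μ.restrict Fᶜ) x = pot K (μ.restrict F) x := by
    have hx' := (hadd x).trans (hFM x hx)
    have : pot K (μ.restrict Fᶜ) x ≠ ⊤ := ne_top_of_le_ne_top hM (hx' ▸ le_add_self)
    exact (ENNReal.eq_sub_of_add_eq this hx').symm
  intro x hx c hc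
  filter_upwards [husc.upperSemicontinuousOn F x hx c ((heq x hx).trans_lt hc),
    self_mem_nhdsWithin] with y hy hyF
  exact (heq y hyF).symm.trans_lt hy

section Potential

variable {Ω : Type*} [MetricSpace Ω] [CompactSpace Ω] [MeasurableSpace Ω] [BorelSpace Ω]
  {K : Ω → Ω → ℝ≥0∞}

theorem measurable_pot (hK : Continuous (Function.uncurry K)) (μ : Measure Ω) [SFinite μ] :
    Measurable (pot K μ) :=
  Measurable.lintegral_prod_right hK.measurable

theorem lintegral_pot_comm (hsym : ∀ x y, K x y = K y x) (hK : Continuous (Function.uncurry K))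
    (μ ν : Measure Ω) [SFinite μ] [SFinite ν] :
    ∫⁻ x, pot K μ x ∂ν = ∫⁻ x, pot K ν x ∂μ := by
  unfold pot
  rw [lintegral_lintegral_swap hK.measurable.aemeasurable]
  simp only [hsym]

theorem energy_smul_add_smul (hsym : ∀ x y, K x y = K y x)
    (hK : Continuous (Function.uncurry K)) (μ ν : Measure Ω) [SFinite μ] [SFinite ν]
    (a b : ℝ≥0∞) :
    energy K (a • μ + b • ν) =
      a ^ 2 * energy K μ + 2 * a * b * ∫⁻ x, pot K μ x ∂ν + b ^ 2 * energy K ν := by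
  have hexpand : energy K (a • μ + b • ν) =
      ∫⁻ x, (a * pot K μ x + b * pot K ν x) ∂(a • μ + b • ν) := by
    simp only [energy, pot, lintegral_add_measure, lintegral_smul_measure, smul_eq_mul]
  have hμ := measurable_pot hK μ
  have hν := measurable_pot hK ν
  rw [hexpand, lintegral_add_left (hμ.const_mul a), lintegral_const_mul _ hμ,
    lintegral_const_mul _ hν]
  simp only [lintegral_add_measure, lintegral_smul_measure, smul_eq_mul]
  rw [lintegral_pot_comm hsym hK ν μ]
  change a * (a * energy K μ + _) + b * (_ + b * energy K ν) = _
  ring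

theorem exists_energy_minimizer [Nonempty Ω] (hK : Continuous (Function.uncurry K)) :
    ∃ μ : Measure Ω, IsProbabilityMeasure μ ∧
      ∀ ν : Measure Ω, IsProbabilityMeasure ν → energy K μ ≤ energy K ν := by
  have hlsc : LowerSemicontinuous fun μ : ProbabilityMeasure Ω => energy K μ := by
    have hrepr (μ : ProbabilityMeasure Ω) : energy K μ =
        ⨆ n : ℕ, ∫⁻ p, ((min (Function.uncurry K p) n).toNNReal : ℝ≥0∞)
          ∂(μ.prod μ : ProbabilityMeasure (Ω × Ω)) := by
      have hfin (p : Ω × Ω) (n : ℕ) :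
          ((min (Function.uncurry K p) n).toNNReal : ℝ≥0∞) = min (Function.uncurry K p) n :=
        ENNReal.coe_toNNReal (ne_top_of_le_ne_top (ENNReal.natCast_ne_top n) (min_le_right _ _))
      simp only [hfin]
      rw [← lintegral_iSup (fun n => hK.measurable.min measurable_const)
        (fun m n hmn p => min_le_min_left _ (by exact_mod_cast hmn))]
      have hsup (p : Ω × Ω) : ⨆ n : ℕ, min (Function.uncurry K p) (n : ℝ≥0∞) =
          Function.uncurry K p := by
        rw [← inf_iSup_eq, ENNReal.iSup_natCast, inf_top_eq]
      simp only [hsup]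
      rw [ProbabilityMeasure.toMeasure_prod, lintegral_prod _ hK.measurable.aemeasurable]
      rfl
    simp only [hrepr]
    refine lowerSemicontinuous_iSup fun n => Continuous.lowerSemicontinuous ?_
    have hc : Continuous fun p : Ω × Ω => (min (Function.uncurry K p) (n : ℝ≥0∞)).toNNReal :=
      ENNReal.continuousOn_toNNReal.comp_continuous (hK.min continuous_const) fun p =>
        ne_top_of_le_ne_top (ENNReal.natCast_ne_top n) (min_le_right _ _)
    have hcont : Continuous fun μ : ProbabilityMeasure Ω => μ.prod μ :=
      ProbabilityMeasure.continuous_prod.comp (continuous_id.prodMk continuous_id)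
    exact (ProbabilityMeasure.continuous_lintegral_continuousMap
      (⟨_, hc⟩ : C(Ω × Ω, NNReal))).comp hcont
  have : Nonempty (ProbabilityMeasure Ω) :=
    ⟨⟨Measure.dirac (Classical.arbitrary Ω), inferInstance⟩⟩
  obtain ⟨μ, -, hμ⟩ := (hlsc.lowerSemicontinuousOn univ).exists_isMinOn univ_nonempty
    isCompact_univ
  exact ⟨μ, inferInstance, fun ν hν => hμ (mem_univ (⟨ν, hν⟩ : ProbabilityMeasure Ω))⟩

/-- Measures of finite energy do not charge sets of capacity zero. -/
theorem CapacityZero.measure_eq_zero {E : Set Ω} (hE : CapacityZero K E)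
    (hEm : MeasurableSet E) (ν : Measure Ω) [IsFiniteMeasure ν] (hν : energy K ν ≠ ⊤) :
    ν E = 0 := by
  by_contra hpos
  obtain ⟨C, hCE, hC, hCpos⟩ := hEm.exists_lt_isCompact (pos_iff_ne_zero.2 hpos)
  have hCpos' : ν C ≠ 0 := hCpos.ne'
  have : IsProbabilityMeasure ((ν C)⁻¹ • ν.restrict C) :=
    ⟨by simp [ENNReal.inv_mul_cancel hCpos' (measure_ne_top ν C)]⟩
  have htop := hE ((ν C)⁻¹ • ν.restrict C) this <| by
    rw [msupp_eq_support]
    refine (Measure.support_subset_of_isClosed hC.isClosed ?_).trans hCE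
    exact Measure.smul_absolutelyContinuous.ae_le (ae_restrict_mem hC.measurableSet)
  have hinv : (ν C)⁻¹ ≠ ⊤ := ENNReal.inv_ne_top.2 hCpos'
  rw [energy_smul hinv] at htop
  exact ENNReal.mul_ne_top hinv (ENNReal.mul_ne_top hinv
    (ne_top_of_le_ne_top hν (energy_mono Measure.restrict_le_self))) htop

theorem energy_le_lintegral_pot_of_minimizer (hsym : ∀ x y, K x y = K y x)
    (hK : Continuous (Function.uncurry K)) (μ : Measure Ω) [IsProbabilityMeasure μ]
    (hmin : ∀ ν : Measure Ω, IsProbabilityMeasure ν → energy K μ ≤ energy K ν)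
    (ν : Measure Ω) [IsProbabilityMeasure ν] (hν : energy K ν ≠ ⊤) :
    energy K μ ≤ ∫⁻ x, pot K μ x ∂ν := by
  by_contra! hlt
  have hμ : energy K μ ≠ ⊤ := ne_top_of_le_ne_top hν (hmin ν inferInstance)
  have hA : ∫⁻ x, pot K μ x ∂ν ≠ ⊤ := hlt.ne_top
  have hmix (t : ℝ) (ht0 : 0 ≤ t) (ht1 : t ≤ 1) :
      (energy K μ).toReal ≤ (1 - t) ^ 2 * (energy K μ).toReal +
        2 * (1 - t) * t * (∫⁻ x, pot K μ x ∂ν).toReal + t ^ 2 * (energy K ν).toReal := by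
    have hp : IsProbabilityMeasure (ENNReal.ofReal (1 - t) • μ + ENNReal.ofReal t • ν) := by
      constructor
      simp [← ENNReal.ofReal_add (sub_nonneg.2 ht1) ht0]
    have h := hmin _ hp
    rw [energy_smul_add_smul hsym hK] at h
    have h' := ENNReal.toReal_mono (by finiteness) h
    rw [ENNReal.toReal_add (by finiteness) (by finiteness),
      ENNReal.toReal_add (by finiteness) (by finiteness)] at h'
    simpa [ENNReal.toReal_ofReal ht0, ENNReal.toReal_ofReal (sub_nonneg.2 ht1)] using h'
  have hlt' : (∫⁻ x, pot K μ x ∂ν).toReal < (energy K μ).toReal :=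
    (ENNReal.toReal_lt_toReal hA hμ).2 hlt
  generalize (∫⁻ x, pot K μ x ∂ν).toReal = A at hmix hlt'
  generalize (energy K μ).toReal = M at hmix hlt'
  generalize (energy K ν).toReal = B at hmix
  set c : ℝ := |M - 2 * A + B| + 1
  have hcpos : 0 < c := by positivity
  have hd : 0 < M - A := sub_pos.2 hlt'
  set t : ℝ := min 1 ((M - A) / c)
  have ht0 : 0 < t := lt_min one_pos (div_pos hd hcpos)
  have htc : t * c ≤ M - A := (le_div_iff₀ hcpos).1 (min_le_right _ _)
  have key := hmix t ht0.le (min_le_left _ _)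
  have hle : t * (M - 2 * A + B) ≤ t * c :=
    mul_le_mul_of_nonneg_left ((le_abs_self _).trans (by linarith)) ht0.le
  have hcontra : 0 < t * (2 * (M - A) - t * (M - 2 * A + B)) := mul_pos ht0 (by linarith)
  nlinarith

/-- The set where the potential of a minimizer lies below its energy has capacity zero. -/
theorem capacityZero_pot_lt_energy (hsym : ∀ x y, K x y = K y x)
    (hK : Continuous (Function.uncurry K)) (μ : Measure Ω) [IsProbabilityMeasure μ]
    (hmin : ∀ ν : Measure Ω, IsProbabilityMeasure ν → energy K μ ≤ energy K ν) :
    CapacityZero K {x | pot K μ x < energy K μ} := by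
  intro ν hν hsupp
  by_contra hfin
  have hμ : energy K μ ≠ ⊤ := ne_top_of_le_ne_top hfin (hmin ν hν)
  have hle := energy_le_lintegral_pot_of_minimizer hsym hK μ hmin ν hfin
  have hae : ∀ᵐ x ∂ν, pot K μ x < energy K μ := by
    rw [msupp_eq_support] at hsupp
    exact Filter.mem_of_superset ν.support_mem_ae hsupp
  have heq : pot K μ =ᵐ[ν] fun _ => energy K μ := by
    refine ae_eq_of_ae_le_of_lintegral_le (hae.mono fun x hx => hx.le) ?_ aemeasurable_const
      (by simpa using hle)
    refine ne_top_of_le_ne_top hμ ?_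
    simpa using lintegral_mono_ae (hae.mono fun x hx => hx.le)
  obtain ⟨x, hx, hx'⟩ := (hae.and heq).exists
  exact hx.ne hx'

/-- The potential of a minimizer equals its energy almost everywhere. -/
theorem pot_ae_eq_energy_of_minimizer (hsym : ∀ x y, K x y = K y x)
    (hK : Continuous (Function.uncurry K)) (μ : Measure Ω) [IsProbabilityMeasure μ]
    (hμ : energy K μ ≠ ⊤)
    (hmin : ∀ ν : Measure Ω, IsProbabilityMeasure ν → energy K μ ≤ energy K ν) :
    ∀ᵐ x ∂μ, pot K μ x = energy K μ := by
  have hge : ∀ᵐ x ∂μ, energy K μ ≤ pot K μ x := by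
    have h := (capacityZero_pot_lt_energy hsym hK μ hmin).measure_eq_zero
      (measurableSet_lt (measurable_pot hK μ) measurable_const) μ hμ
    filter_upwards [measure_eq_zero_iff_ae_notMem.1 h] with x hx using not_lt.1 hx
  refine (ae_eq_of_ae_le_of_lintegral_le hge (by simpa using hμ)
    (measurable_pot hK μ).aemeasurable ?_).symm
  simp [energy, pot]

/-- A continuous potential is locally constant at a maximum point outside the support. -/
theorem eventually_pot_eq_of_isMax {σ : Measure Ω} [IsProbabilityMeasure σ]
    (hσfull : ∀ (x : Ω) (r : ℝ), 0 < r → 0 < σ (closedBall x r))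
    (hK : Continuous (Function.uncurry K)) (hsubh : EntirelySubharmonic σ K)
    (ν : Measure Ω) [IsFiniteMeasure ν] (hcont : Continuous (pot K ν)) {x₀ : Ω}
    (hfin : pot K ν x₀ ≠ ⊤) (hmax : ∀ x, pot K ν x ≤ pot K ν x₀) (hx₀ : x₀ ∉ msupp ν) :
    ∀ᶠ x in nhds x₀, pot K ν x = pot K ν x₀ := by
  obtain ⟨R, hR, hsub⟩ := hsubh
  rw [msupp_eq_support] at hx₀
  obtain ⟨ε, hε, hball⟩ := Metric.isOpen_iff.1 ν.isOpen_compl_support x₀ hx₀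
  set r : ℝ := min ε R / 2
  have hmin : 0 < min ε R := lt_min hε hR
  have hr0 : 0 < r := half_pos hmin
  have hrmin : r < min ε R := half_lt_self hmin
  have hrR : r < R := hrmin.trans_le (min_le_right _ _)
  have hdisj : closedBall x₀ r ⊆ ν.supportᶜ :=
    (closedBall_subset_ball (hrmin.trans_le (min_le_left _ _))).trans hball
  have hσ0 : σ (closedBall x₀ r) ≠ 0 := (hσfull x₀ r hr0).ne'
  have hσtop : σ (closedBall x₀ r) ≠ ⊤ := measure_ne_top _ _
  have hmean : pot K ν x₀ ≤ (∫⁻ z in closedBall x₀ r, pot K ν z ∂σ) / σ (closedBall x₀ r) := by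
    calc pot K ν x₀
        ≤ ∫⁻ y, (∫⁻ z in closedBall x₀ r, K z y ∂σ) / σ (closedBall x₀ r) ∂ν := by
          refine lintegral_mono_ae ?_
          filter_upwards [ν.support_mem_ae] with y hy
          refine (hsub y).2 x₀ r hr0 hrR fun z hz hzy => hdisj hz ?_
          rwa [mem_singleton_iff.1 hzy]
      _ = _ := by
          simp only [div_eq_mul_inv]
          rw [lintegral_mul_const' _ _ (ENNReal.inv_ne_top.2 hσ0)]
          unfold pot
          rw [lintegral_lintegral_swap hK.measurable.aemeasurable]
  have hint : pot K ν x₀ * σ (closedBall x₀ r) ≤ ∫⁻ z in closedBall x₀ r, pot K ν z ∂σ :=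
    (ENNReal.le_div_iff_mul_le (Or.inl hσ0) (Or.inl hσtop)).1 hmean
  have hae : pot K ν =ᵐ[σ.restrict (closedBall x₀ r)] fun _ => pot K ν x₀ := by
    refine ae_eq_of_ae_le_of_lintegral_le (Filter.Eventually.of_forall hmax) ?_
      aemeasurable_const (by simpa using hint)
    refine ne_top_of_le_ne_top (ENNReal.mul_ne_top hfin hσtop) ?_
    simpa using lintegral_mono (μ := σ.restrict (closedBall x₀ r)) hmax
  filter_upwards [ball_mem_nhds x₀ hr0] with z hz
  by_contra hne
  have hopen : IsOpen (ball x₀ r ∩ {w | pot K ν w ≠ pot K ν x₀}) :=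
    isOpen_ball.inter (isOpen_ne_fun hcont continuous_const)
  obtain ⟨s, hs, hsub'⟩ := Metric.nhds_basis_closedBall.mem_iff.1 (hopen.mem_nhds ⟨hz, hne⟩)
  refine (hσfull z s hs).ne' (measure_mono_null hsub' ?_)
  rw [Filter.EventuallyEq, ae_restrict_iff' measurableSet_closedBall] at hae
  refine measure_mono_null ?_ hae
  exact fun w hw h => hw.2 (h (ball_subset_closedBall hw.1))

/-- Maximum principle for continuous potentials. -/
theorem pot_le_of_forall_mem_msupp [ConnectedSpace Ω] {σ : Measure Ω} [IsProbabilityMeasure σ]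
    (hσfull : ∀ (x : Ω) (r : ℝ), 0 < r → 0 < σ (closedBall x r))
    (hK : Continuous (Function.uncurry K)) (hsubh : EntirelySubharmonic σ K)
    (ν : Measure Ω) [IsFiniteMeasure ν] (hcont : Continuous (pot K ν))
    (hfin : ∀ x, pot K ν x ≠ ⊤) {M : ℝ≥0∞} (hM : ∀ x ∈ msupp ν, pot K ν x ≤ M) (x : Ω) :
    pot K ν x ≤ M := by
  by_cases hν : ν = 0
  · simp [hν, pot]
  obtain ⟨x₀, -, hx₀⟩ := isCompact_univ.exists_isMaxOn univ_nonempty hcont.continuousOn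
  have hmax (x : Ω) : pot K ν x ≤ pot K ν x₀ := hx₀ (mem_univ x)
  suffices ∃ z ∈ msupp ν, pot K ν z = pot K ν x₀ by
    obtain ⟨z, hz, hzeq⟩ := this
    exact (hmax x).trans (hzeq ▸ hM z hz)
  by_contra! hnone
  have hclopen : IsClopen {z | pot K ν z = pot K ν x₀} := by
    refine ⟨isClosed_eq hcont continuous_const, isOpen_iff_mem_nhds.2 fun z hz => ?_⟩
    have hz' : pot K ν z = pot K ν x₀ := hz
    have h := eventually_pot_eq_of_isMax hσfull hK hsubh ν hcont (hfin z)
      (fun w => (hmax w).trans hz'.ge) fun hzs => hnone z hzs hz'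
    rwa [hz'] at h
  obtain ⟨z, hz⟩ := Measure.nonempty_support hν
  rw [← msupp_eq_support] at hz
  have huniv := hclopen.eq_univ ⟨x₀, rfl⟩
  exact hnone z hz (huniv.ge (mem_univ z))

/-- The potential of a minimizer is bounded by its energy everywhere. -/
theorem pot_le_energy_of_minimizer [ConnectedSpace Ω] {σ : Measure Ω} [IsProbabilityMeasure σ]
    (hσfull : ∀ (x : Ω) (r : ℝ), 0 < r → 0 < σ (closedBall x r))
    (hsym : ∀ x y, K x y = K y x) (hK : Continuous (Function.uncurry K))
    (hreg : Regular K) (hsubh : EntirelySubharmonic σ K)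
    (μ : Measure Ω) [IsProbabilityMeasure μ] (hμ : energy K μ ≠ ⊤)
    (hmin : ∀ ν : Measure Ω, IsProbabilityMeasure ν → energy K μ ≤ energy K ν) (x : Ω) :
    pot K μ x ≤ energy K μ := by
  have hae := pot_ae_eq_energy_of_minimizer hsym hK μ hμ hmin
  set S : Set Ω := {x | pot K μ x = energy K μ}
  have hS : MeasurableSet S := measurableSet_eq_fun (measurable_pot hK μ) measurable_const
  have hcompact {F : Set Ω} (hF : IsCompact F) (hFS : F ⊆ S) :
      pot K (μ.restrict F) x ≤ energy K μ := by
    have hsupp : msupp (μ.restrict F) ⊆ F := by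
      rw [msupp_eq_support]
      exact Measure.support_subset_of_isClosed hF.isClosed (ae_restrict_mem hF.measurableSet)
    have hle : ∀ y ∈ msupp (μ.restrict F), pot K (μ.restrict F) y ≤ energy K μ := fun y hy =>
      (lintegral_mono' Measure.restrict_le_self le_rfl).trans (hFS (hsupp hy)).le
    obtain ⟨hcont, hfin⟩ := hreg (μ.restrict F) inferInstance
      ((continuousOn_pot_restrict hK μ hF hμ fun y hy => hFS hy).mono hsupp)
      fun y hy => ne_top_of_le_ne_top hμ (hle y hy)
    exact pot_le_of_forall_mem_msupp hσfull hK hsubh _ hcont hfin hle x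
  have hexists (n : ℕ) : ∃ F ⊆ S, IsCompact F ∧ μ (S \ F) < (n + 1 : ℝ≥0∞)⁻¹ :=
    hS.exists_isCompact_sdiff_lt (measure_ne_top _ _) (by simp)
  choose F hFS hF hFμ using hexists
  have hunion : μ (⋃ n, accumulate F n)ᶜ = 0 := by
    rw [iUnion_accumulate]
    have hnull : μ (S \ ⋃ n, F n) = 0 := by
      refine le_antisymm (ge_of_tendsto' (x := Filter.atTop)
        (f := fun n : ℕ => (n + 1 : ℝ≥0∞)⁻¹) ?_ fun n => ?_) zero_le
      · exact_mod_cast ENNReal.tendsto_inv_nat_nhds_zero.comp (Filter.tendsto_add_atTop_nat 1)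
      · exact (measure_mono (sdiff_subset_sdiff_right (subset_iUnion F n))).trans (hFμ n).le
    refine measure_mono_null (t := Sᶜ ∪ (S \ ⋃ n, F n)) ?_ (measure_union_null hae hnull)
    intro y hy
    by_cases hyS : y ∈ S
    · exact Or.inr ⟨hyS, hy⟩
    · exact Or.inl hyS
  have hacc (n : ℕ) : IsCompact (accumulate F n) :=
    isCompact_accumulate hF n
  have hrestrict : μ.restrict (⋃ n, accumulate F n) = μ :=
    Measure.restrict_eq_self_of_ae_mem (measure_eq_zero_iff_ae_notMem.1 hunion |>.mono
      fun y hy => not_notMem.1 hy)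
  calc pot K μ x = ∫⁻ y in ⋃ n, accumulate F n, K x y ∂μ := by rw [hrestrict]; rfl
    _ = ⨆ n, ∫⁻ y in accumulate F n, K x y ∂μ :=
      setLIntegral_iUnion_of_directed _ (monotone_accumulate.directed_le)
    _ ≤ energy K μ := iSup_le fun n => hcompact (hacc n) (iUnion₂_subset fun m _ => hFS m)

/-- Energy minimizers are approximately invariant, with constant their energy. -/
theorem capacityZero_pot_ne_energy_of_minimizer [ConnectedSpace Ω] {σ : Measure Ω}
    [IsProbabilityMeasure σ]
    (hσfull : ∀ (x : Ω) (r : ℝ), 0 < r → 0 < σ (closedBall x r))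
    (hsym : ∀ x y, K x y = K y x) (hK : Continuous (Function.uncurry K))
    (hreg : Regular K) (hsubh : EntirelySubharmonic σ K)
    (μ : Measure Ω) [IsProbabilityMeasure μ] (hμ : energy K μ ≠ ⊤)
    (hmin : ∀ ν : Measure Ω, IsProbabilityMeasure ν → energy K μ ≤ energy K ν) :
    CapacityZero K {x | pot K μ x ≠ energy K μ} := by
  have hle := pot_le_energy_of_minimizer hσfull hsym hK hreg hsubh μ hμ hmin
  have hset : {x | pot K μ x ≠ energy K μ} = {x | pot K μ x < energy K μ} := by
    ext x
    exact ⟨fun h => (hle x).lt_of_ne h, fun h => h.ne⟩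
  rw [hset]
  exact capacityZero_pot_lt_energy hsym hK μ hmin

/-- If the potential of `μ` is `M` off a set of capacity zero, then its integral against any
probability measure of finite energy is `M`. -/
theorem lintegral_pot_eq_of_capacityZero (hK : Continuous (Function.uncurry K))
    {μ ν : Measure Ω} [IsFiniteMeasure μ] [IsProbabilityMeasure ν] {M : ℝ≥0∞}
    (hM : CapacityZero K {x | pot K μ x ≠ M}) (hν : energy K ν ≠ ⊤) :
    ∫⁻ x, pot K μ x ∂ν = M := by
  have hnull := hM.measure_eq_zero
    (measurableSet_eq_fun (measurable_pot hK μ) measurable_const).compl ν hν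
  have hae : pot K μ =ᵐ[ν] fun _ => M := hnull
  rw [lintegral_congr_ae hae]
  simp

end Potential

/-- For a regular, entirely subharmonic, symmetric extended-continuous kernel on a compact
connected metric space of positive capacity in which every nonempty ball has positive
capacity, a probability measure is an energy minimizer if and only if it is approximately
`K`-invariant. -/
theorem minimizer_iff_approxInvariant
    {Ω : Type*} [MetricSpace Ω] [CompactSpace Ω] [ConnectedSpace Ω]
    [MeasurableSpace Ω] [BorelSpace Ω]
    (σ : Measure Ω) [IsProbabilityMeasure σ]
    (hσfull : ∀ (x : Ω) (r : ℝ), 0 < r → 0 < σ (closedBall x r))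
    (K : Ω → Ω → ℝ≥0∞) (hsym : ∀ x y, K x y = K y x)
    (hKcont : Continuous (Function.uncurry K))
    (hreg : Regular K) (hsubh : EntirelySubharmonic σ K)
    (hposcap : ∃ ν : Measure Ω, IsProbabilityMeasure ν ∧ energy K ν ≠ ⊤)
    (hballcap : ∀ (x : Ω) (r : ℝ), 0 < r → ∃ ν : Measure Ω, IsProbabilityMeasure ν ∧
      msupp ν ⊆ closedBall x r ∧ energy K ν ≠ ⊤)
    (μ : Measure Ω) [IsProbabilityMeasure μ] :
    (∀ ν : Measure Ω, IsProbabilityMeasure ν → energy K μ ≤ energy K ν) ↔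
      ApproxInvariant K μ := by
  obtain ⟨ν₀, hν₀, hν₀fin⟩ := hposcap
  constructor
  · intro hmin
    have hμ : energy K μ ≠ ⊤ := ne_top_of_le_ne_top hν₀fin (hmin ν₀ hν₀)
    exact ⟨inferInstance, hμ, energy K μ, hμ,
      capacityZero_pot_ne_energy_of_minimizer hσfull hsym hKcont hreg hsubh μ hμ hmin⟩
  · rintro ⟨-, hμ, M, -, hM⟩ ν hν
    obtain ⟨τ, hτprob, hτmin⟩ := exists_energy_minimizer hKcont
    have hτ : energy K τ ≠ ⊤ := ne_top_of_le_ne_top hν₀fin (hτmin ν₀ hν₀)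
    have hτcap :=
      capacityZero_pot_ne_energy_of_minimizer hσfull hsym hKcont hreg hsubh τ hτ hτmin
    calc energy K μ = M := lintegral_pot_eq_of_capacityZero hKcont hM hμ
      _ = ∫⁻ x, pot K μ x ∂τ := (lintegral_pot_eq_of_capacityZero hKcont hM hτ).symm
      _ = ∫⁻ x, pot K τ x ∂μ := lintegral_pot_comm hsym hKcont μ τ
      _ = energy K τ := lintegral_pot_eq_of_capacityZero hKcont hτcap hμ
      _ ≤ energy K ν := hτmin ν hν
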